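/- Let (X(t))_{t≥0} be a non-increasing sequence of discrete random variables taking values in [0,∞) with X(0) = x₀ fixed. Suppose there exist an increasing function h : [0,∞) → (0,∞) and a constant σ > 0 such that for all t ∈ ℕ and all x > 0 with P[X(t) = x] > 0: (1) E[X(t+1) | X(t) = x] ≤ x − h(x), and (2) Var[X(t+1) | X(t) = x] ≤ σ·(E[X(t+1) | X(t) = x] − x)². Then for every δ ∈ (0,1) and every p ∈ (0,1), setting t₀ := (2(σ+1)/δ²)·( −log p + log(2(σ+1)/δ²) ), it holds that P[ Σ_{t=t₀+1}^{∞} X(t) ≤ (1/(1−δ))·∫₀^{x₀} φ/h(φ) dφ ] ≥ 1 − p. -/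

import Mathlib

open MeasureTheory ProbabilityTheory Real
open scoped ENNReal BigOperators

lemma aux_exp_quad {y : ℝ} (hy : 0 ≤ y) : Real.exp (-y) ≤ 1 - y + y ^ 2 / 2 := by
  have h1 := Real.quadratic_le_exp_of_nonneg hy
  have h3 : 0 < 1 - y + y ^ 2 / 2 := by nlinarith [sq_nonneg (y - 1)]
  rw [Real.exp_neg, inv_le_comm₀ (Real.exp_pos y) h3]
  refine le_trans ?_ h1
  rw [inv_le_iff_one_le_mul₀ h3]
  nlinarith [sq_nonneg (y ^ 2)]

lemma aux_one_sub {u : ℝ} (hu : 0 ≤ u) (hu1 : u < 1) : 1 - u ≤ Real.exp (-u - u ^ 2 / 2) := by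
  have hs := Real.hasSum_pow_div_log_of_abs_lt_one (x := u) (by rw [abs_of_nonneg hu]; exact hu1)
  have h2 := hs.summable.sum_le_tsum (Finset.range 2) (fun i _ => by positivity)
  rw [hs.tsum_eq] at h2
  simp [Finset.sum_range_succ] at h2
  rw [← Real.log_le_iff_le_exp (by linarith)]
  norm_num at h2
  linarith

lemma aux_num {c : ℝ} (hc : 0 < c) (hc2 : c ≤ 1 / 2) :
    c * Real.exp (c / 2 * Real.log c) ≤ 1 - Real.exp (-(c + c ^ 2 / 2)) := by
  have hlog : Real.log c ≤ -0.69 := by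
    have : Real.log c ≤ Real.log (1 / 2) := Real.log_le_log hc hc2
    have h2 := Real.log_two_gt_d9
    rw [Real.log_div (by norm_num) (by norm_num), Real.log_one] at this
    linarith
  have h1 : Real.exp (c / 2 * Real.log c) ≤ 1 / (1 + 0.345 * c) := by
    have : Real.exp (c / 2 * Real.log c) ≤ Real.exp (-(0.345 * c)) := by
      apply Real.exp_le_exp.2; nlinarith
    refine this.trans ?_
    rw [Real.exp_neg, ← one_div]
    apply one_div_le_one_div_of_le (by positivity)
    have := Real.add_one_le_exp (0.345 * c); linarith
  have h2 : Real.exp (-(c + c ^ 2 / 2)) ≤ 1 / (1 + c + c ^ 2) := by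
    rw [Real.exp_neg, ← one_div]
    apply one_div_le_one_div_of_le (by positivity)
    have := Real.quadratic_le_exp_of_nonneg (x := c + c ^ 2 / 2) (by positivity)
    nlinarith [pow_pos hc 3, pow_pos hc 4]
  have h3 : c * (1 / (1 + 0.345 * c)) ≤ 1 - 1 / (1 + c + c ^ 2) := by
    rw [mul_one_div, div_le_iff₀ (by positivity), sub_mul, le_sub_iff_add_le, ← le_sub_iff_add_le',
      div_mul_eq_mul_div, div_le_iff₀ (by positivity)]
    nlinarith [pow_pos hc 2, pow_pos hc 3]
  have := mul_le_mul_of_nonneg_left h1 hc.le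
  linarith

lemma aux_sum {c p t₀ : ℝ} (hc : 0 < c) (hc2 : c ≤ 1 / 2) (hp0 : 0 < p) (hp1 : p < 1)
    (ht₀ : t₀ = 1 / c * (-Real.log p + Real.log (1 / c))) :
    (∑' s : ℕ, if t₀ < (s : ℝ) then ENNReal.ofReal (Real.exp (-(c + c ^ 2 / 2)) ^ s) else 0)
      ≤ ENNReal.ofReal p := by
  set r := Real.exp (-(c + c ^ 2 / 2)) with hr
  have hr0 : 0 < r := Real.exp_pos _
  have hr1 : r < 1 := by
    rw [hr, ← Real.exp_zero]; apply Real.exp_lt_exp.2; nlinarith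
  have hn := aux_num hc hc2
  rw [← hr] at hn
  have hlp : Real.log p < 0 := Real.log_neg hp0 hp1
  have ht0 : 0 ≤ t₀ := by
    have : Real.log c ≤ 0 := Real.log_nonpos hc.le (by linarith)
    rw [ht₀, Real.log_div one_ne_zero hc.ne', Real.log_one]
    apply mul_nonneg (by positivity); linarith
  set m := ⌊t₀⌋₊ + 1 with hm
  have hmt : t₀ < m := by rw [hm]; push_cast; exact Nat.lt_floor_add_one t₀
  have hlt : ∀ s : ℕ, t₀ < (s : ℝ) → m ≤ s := fun s hs => by
    have := (Nat.floor_lt ht0).2 hs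
    omega
  have hrm : r ^ m ≤ p * (1 - r) := by
    have e1 : r ^ m = Real.exp (-(c + c ^ 2 / 2) * m) := by
      rw [hr, ← Real.exp_nat_mul]; congr 1; ring
    have e2 : -(c + c ^ 2 / 2) * m ≤ Real.log p + (Real.log c + c / 2 * Real.log c) := by
      have : -(c + c ^ 2 / 2) * m ≤ -(c + c ^ 2 / 2) * t₀ := by
        have : 0 < c + c ^ 2 / 2 := by positivity
        nlinarith
      refine this.trans ?_
      rw [ht₀, Real.log_div one_ne_zero hc.ne', Real.log_one]
      have : -(c + c ^ 2 / 2) * (1 / c * (-Real.log p + (0 - Real.log c)))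
        = (1 + c / 2) * (Real.log p + Real.log c) := by field_simp; ring
      rw [this]; nlinarith
    rw [e1]
    refine (Real.exp_le_exp.2 e2).trans ?_
    rw [Real.exp_add, Real.exp_add, Real.exp_log hp0, Real.exp_log hc]
    exact mul_le_mul_of_nonneg_left hn hp0.le
  have hS : Summable (fun s : ℕ => if m ≤ s then r ^ s else 0) := by
    refine Summable.of_nonneg_of_le (fun s => ?_) (fun s => ?_) (summable_geometric_of_lt_one hr0.le hr1)
    · split_ifs <;> positivity
    · split_ifs
      · exact le_rfl
      · positivity
  have hT : ∑' s : ℕ, (if m ≤ s then r ^ s else 0) = r ^ m / (1 - r) := by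
    rw [← hS.sum_add_tsum_nat_add m]
    rw [Finset.sum_eq_zero (fun i hi => if_neg (by simpa using hi))]
    simp [pow_add, tsum_mul_right, tsum_geometric_of_lt_one hr0.le hr1]
    field_simp
  calc _ ≤ ∑' s : ℕ, ENNReal.ofReal (if m ≤ s then r ^ s else 0) := by
        refine ENNReal.tsum_le_tsum fun s => ?_
        split_ifs with h1 h2 h2
        · exact le_rfl
        · exact absurd (hlt s h1) h2
        · exact zero_le
        · simp
    _ = ENNReal.ofReal (r ^ m / (1 - r)) := by
        rw [← hT, ENNReal.ofReal_tsum_of_nonneg _ hS]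
        intro s; split_ifs <;> positivity
    _ ≤ _ := by
        apply ENNReal.ofReal_le_ofReal
        rw [div_le_iff₀ (by linarith)]; exact hrm

/-- potential -/
noncomputable def auxH (h : ℝ → ℝ) (x₀ x : ℝ) : ℝ := ∫ φ in x..x₀, 1 / h φ

lemma auxInt {h : ℝ → ℝ} (hm : Monotone h) (hp : ∀ x, 0 < h x) (a b : ℝ) :
    IntervalIntegrable (fun φ => 1 / h φ) volume a b := by
  apply Antitone.intervalIntegrable
  intro x y hxy
  exact one_div_le_one_div_of_le (hp x) (hm hxy)

lemma auxH_anti {h : ℝ → ℝ} (hm : Monotone h) (hp : ∀ x, 0 < h x) (x₀ : ℝ) :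
    Antitone (auxH h x₀) := by
  intro a b hab
  have := intervalIntegral.integral_add_adjacent_intervals (auxInt hm hp a b) (auxInt hm hp b x₀)
  have h2 : 0 ≤ ∫ φ in a..b, 1 / h φ :=
    intervalIntegral.integral_nonneg hab fun u _ => (one_div_pos.2 (hp u)).le
  unfold auxH; linarith

lemma auxH_diff {h : ℝ → ℝ} (hm : Monotone h) (hp : ∀ x, 0 < h x) (x₀ : ℝ) {y x : ℝ} (hyx : y ≤ x) :
    auxH h x₀ x + (x - y) / h x ≤ auxH h x₀ y := by
  have := intervalIntegral.integral_add_adjacent_intervals (auxInt hm hp y x) (auxInt hm hp x x₀)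
  have h2 : ∫ φ in y..x, 1 / h x ≤ ∫ φ in y..x, 1 / h φ :=
    intervalIntegral.integral_mono_on hyx (by simp) (auxInt hm hp y x)
      fun u hu => one_div_le_one_div_of_le (hp u) (hm hu.2)
  rw [intervalIntegral.integral_const, smul_eq_mul, mul_one_div] at h2
  unfold auxH; linarith

lemma aux_fubini {h : ℝ → ℝ} (hm : Monotone h) (hp : ∀ x, 0 < h x) {x₀ : ℝ} (hx0 : 0 ≤ x₀) :
    ∫⁻ φ in Set.Ioc 0 x₀, ENNReal.ofReal (auxH h x₀ φ) =
      ENNReal.ofReal (∫ φ in (0:ℝ)..x₀, φ / h φ) := by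
  have hmeas : Measurable (fun φ => ENNReal.ofReal (1 / h φ)) :=
    (measurable_const.div hm.measurable).ennreal_ofReal
  have e1 : ∀ φ ∈ Set.Ioc 0 x₀, ENNReal.ofReal (auxH h x₀ φ) =
      ∫⁻ ψ in Set.Ioc 0 x₀, (if φ < ψ then ENNReal.ofReal (1 / h ψ) else 0) := by
    intro φ hφ
    unfold auxH
    rw [intervalIntegral.integral_of_le hφ.2, ofReal_integral_eq_lintegral_ofReal
      (auxInt hm hp φ x₀).1 (ae_of_all _ fun u => (one_div_pos.2 (hp u)).le)]
    rw [← lintegral_indicator measurableSet_Ioc, ← lintegral_indicator measurableSet_Ioc]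
    congr 1; ext ψ
    by_cases h1 : φ < ψ <;> by_cases h2 : ψ ≤ x₀ <;> simp [Set.indicator, h1, h2, hφ.1.trans]
  rw [setLIntegral_congr_fun measurableSet_Ioc e1, lintegral_lintegral_swap]
  · have hii : IntervalIntegrable (fun φ => φ / h φ) volume 0 x₀ := by
      have := (auxInt hm hp 0 x₀).continuousOn_mul (g := fun φ => φ) continuousOn_id
      simpa only [mul_one_div] using this
    rw [intervalIntegral.integral_of_le hx0, ofReal_integral_eq_lintegral_ofReal hii.1
      ((ae_restrict_iff' measurableSet_Ioc).2 (ae_of_all _ fun u hu => (div_pos hu.1 (hp u)).le))]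
    refine setLIntegral_congr_fun measurableSet_Ioc fun ψ hψ => ?_
    have : (fun φ => if φ < ψ then ENNReal.ofReal (1 / h ψ) else 0)
       = (Set.Iio ψ).indicator (fun _ => ENNReal.ofReal (1 / h ψ)) := by
      ext φ; simp [Set.indicator]
    simp only [this]
    rw [lintegral_indicator measurableSet_Iio, setLIntegral_const, Measure.restrict_apply measurableSet_Iio]
    have : Set.Iio ψ ∩ Set.Ioc 0 x₀ = Set.Ioo 0 ψ := by
      ext φ; simp only [Set.mem_inter_iff, Set.mem_Iio, Set.mem_Ioc, Set.mem_Ioo]; constructor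
      · exact fun b => ⟨b.2.1, b.1⟩
      · exact fun b => ⟨b.2, b.1, by linarith [hψ.2]⟩
    rw [this, Real.volume_Ioo, ← ENNReal.ofReal_mul (one_div_pos.2 (hp ψ)).le]
    congr 1; ring
  · apply Measurable.aemeasurable
    exact Measurable.ite (measurableSet_lt measurable_fst measurable_snd)
      (hmeas.comp measurable_snd) measurable_const

lemma aux_det {h : ℝ → ℝ} (hm : Monotone h) (hp : ∀ x, 0 < h x) {x₀ : ℝ} (hx0 : 0 ≤ x₀)
    (x : ℕ → ℝ) (hxx : ∀ s, x s ≤ x₀) {δ t₀ : ℝ} (hδ : δ < 1) (ht₀ : 0 ≤ t₀)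
    (hgood : ∀ s : ℕ, t₀ < s → 0 < x s → (1 - δ) * s ≤ auxH h x₀ (x s)) :
    (∑' s : ℕ, if t₀ < (s : ℝ) then ENNReal.ofReal (x s) else 0)
      ≤ ENNReal.ofReal ((1 / (1 - δ)) * ∫ φ in (0:ℝ)..x₀, φ / h φ) := by
  have hd : 0 < 1 - δ := by linarith
  have e1 : ∀ s : ℕ, (if t₀ < (s : ℝ) then ENNReal.ofReal (x s) else 0) =
      ∫⁻ φ in Set.Ioc 0 x₀, (if t₀ < (s : ℝ) then (Set.Iio (x s)).indicator (fun _ => (1 : ℝ≥0∞)) φ else 0) := by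
    intro s
    split_ifs
    · rw [lintegral_indicator measurableSet_Iio, setLIntegral_const, one_mul,
        Measure.restrict_apply measurableSet_Iio]
      have : Set.Iio (x s) ∩ Set.Ioc 0 x₀ = Set.Ioo 0 (x s) := by
        ext φ; simp only [Set.mem_inter_iff, Set.mem_Iio, Set.mem_Ioc, Set.mem_Ioo]; constructor
        · exact fun b => ⟨b.2.1, b.1⟩
        · exact fun b => ⟨b.2, b.1, by linarith [hxx s]⟩
      rw [this, Real.volume_Ioo, sub_zero]
    · simp
  simp_rw [e1]
  rw [← lintegral_tsum]
  · rw [ENNReal.ofReal_mul (by positivity), ← aux_fubini hm hp hx0, ← lintegral_const_mul]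
    · refine setLIntegral_mono' measurableSet_Ioc fun φ hφ => ?_
      rw [← ENNReal.ofReal_mul (by positivity)]
      set N := ⌊1 / (1 - δ) * auxH h x₀ φ⌋₊ with hN
      have hH0 : 0 ≤ auxH h x₀ φ := by
        have := auxH_anti hm hp x₀ hφ.2
        simpa [auxH] using this
      have key : ∀ s : ℕ, t₀ < s → φ < x s → s ∈ Finset.Icc 1 N := by
        intro s h1 h2
        rw [Finset.mem_Icc]
        constructor
        · have : (0:ℝ) < s := by linarith
          exact_mod_cast this
        · apply Nat.le_floor
          have h3 := hgood s h1 (hφ.1.trans h2)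
          have h4 := auxH_anti hm hp x₀ h2.le
          rw [one_div_mul_eq_div, le_div_iff₀ hd]; linarith
      calc _ = ∑ s ∈ Finset.Icc 1 N, (if t₀ < (s : ℝ) then (Set.Iio (x s)).indicator (fun _ => (1 : ℝ≥0∞)) φ else 0) := by
            apply tsum_eq_sum
            intro s hs
            split_ifs with h1
            · simp only [Set.indicator, Set.mem_Iio]
              exact if_neg fun h2 => hs (key s h1 h2)
            · rfl
        _ ≤ ∑ s ∈ Finset.Icc 1 N, 1 := by
            apply Finset.sum_le_sum
            intro s _
            simp only [Set.indicator]
            split_ifs <;> simp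
        _ = ENNReal.ofReal (N : ℝ) := by simp
        _ ≤ _ := by
            apply ENNReal.ofReal_le_ofReal
            exact Nat.floor_le (by positivity)
    · exact (auxH_anti hm hp x₀).measurable.ennreal_ofReal
  · intro s
    apply Measurable.aemeasurable
    split_ifs
    · exact measurable_const.indicator measurableSet_Iio
    · exact measurable_const

lemma aux_cond {Ω : Type*} [MeasurableSpace Ω] (ν : Measure Ω) [IsProbabilityMeasure ν]
    (Y : Ω → ℝ) (hY : Measurable Y) (hY0 : ∀ ω, 0 ≤ Y ω) {x k σ l : ℝ} (hYx : ∀ᵐ ω ∂ν, Y ω ≤ x)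
    (hk : 0 < k) (hl : 0 ≤ l)
    (hdrift : ∫ ω, Y ω ∂ν ≤ x - k)
    (hvar : ∫ ω, (Y ω - ∫ ω', Y ω' ∂ν) ^ 2 ∂ν ≤ σ * ((∫ ω, Y ω ∂ν) - x) ^ 2) :
    ∫⁻ ω, ENNReal.ofReal (Real.exp (-(l * ((x - Y ω) / k)))) ∂ν
      ≤ ENNReal.ofReal (1 - l + l ^ 2 * (1 + σ) / 2) := by
  set E := ∫ ω, Y ω ∂ν with hE
  set m := x - E with hm
  have hmk : k ≤ m := by linarith
  have hm0 : 0 < m := by linarith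
  have hYint : Integrable Y ν := by
    apply Integrable.of_bound hY.aestronglyMeasurable x
    filter_upwards [hYx] with ω h1
    rw [Real.norm_of_nonneg (hY0 ω)]; exact h1
  have hY2 : Integrable (fun ω => (Y ω - E) ^ 2) ν := by
    apply Integrable.of_bound (hY.sub_const E |>.pow_const 2).aestronglyMeasurable ((x + |E|) ^ 2)
    filter_upwards [hYx] with ω h1
    rw [Real.norm_of_nonneg (sq_nonneg _)]
    apply sq_le_sq'
    · linarith [hY0 ω, le_abs_self E]
    · linarith [hY0 ω, neg_abs_le E]
  have hF : ∀ ω, 1 - l * ((x - Y ω) / m) + (l * ((x - Y ω) / m)) ^ 2 / 2 =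
      (1 - l + l ^ 2 / 2) + ((l / m - l ^ 2 / m) * (Y ω - E) + (l ^ 2 / (2 * m ^ 2)) * (Y ω - E) ^ 2) := by
    intro ω
    have : x = m + E := by rw [hm]; ring
    rw [this]; field_simp; ring
  have hi1 : Integrable (fun ω => (l / m - l ^ 2 / m) * (Y ω - E)) ν :=
    (hYint.sub (integrable_const E)).const_mul _
  have hi2 : Integrable (fun ω => (l ^ 2 / (2 * m ^ 2)) * (Y ω - E) ^ 2) ν := hY2.const_mul _
  have hFint : Integrable (fun ω => 1 - l * ((x - Y ω) / m) + (l * ((x - Y ω) / m)) ^ 2 / 2) ν := by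
    simp_rw [hF]
    exact (integrable_const _).add (hi1.add hi2)
  calc _ ≤ ∫⁻ ω, ENNReal.ofReal (1 - l * ((x - Y ω) / m) + (l * ((x - Y ω) / m)) ^ 2 / 2) ∂ν := by
        apply lintegral_mono_ae
        filter_upwards [hYx] with ω h1
        apply ENNReal.ofReal_le_ofReal
        have hD : 0 ≤ x - Y ω := by linarith
        refine le_trans ?_ (aux_exp_quad (by positivity))
        apply Real.exp_le_exp.2
        have : (x - Y ω) / m ≤ (x - Y ω) / k := by gcongr
        have := mul_le_mul_of_nonneg_left this hl
        linarith
    _ = ENNReal.ofReal (∫ ω, (1 - l * ((x - Y ω) / m) + (l * ((x - Y ω) / m)) ^ 2 / 2) ∂ν) := by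
        rw [ofReal_integral_eq_lintegral_ofReal hFint]
        refine ae_of_all _ fun ω => ?_
        show 0 ≤ 1 - l * ((x - Y ω) / m) + (l * ((x - Y ω) / m)) ^ 2 / 2
        nlinarith [sq_nonneg (l * ((x - Y ω) / m) - 1)]
    _ ≤ _ := by
        apply ENNReal.ofReal_le_ofReal
        simp_rw [hF]
        rw [integral_add (integrable_const _) (show Integrable (fun ω => (l / m - l ^ 2 / m) * (Y ω - E) +
            (l ^ 2 / (2 * m ^ 2)) * (Y ω - E) ^ 2) ν from hi1.add hi2), integral_add hi1 hi2,
          integral_const_mul, integral_const_mul, integral_sub hYint (integrable_const E)]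
        simp only [integral_const, probReal_univ, one_smul]
        rw [← hE, sub_self, mul_zero, zero_add]
        have h2 : l ^ 2 / (2 * m ^ 2) * ∫ ω, (Y ω - E) ^ 2 ∂ν ≤ l ^ 2 / (2 * m ^ 2) * (σ * (E - x) ^ 2) :=
          mul_le_mul_of_nonneg_left hvar (by positivity)
        have h3 : l ^ 2 / (2 * m ^ 2) * (σ * (E - x) ^ 2) = l ^ 2 * σ / 2 := by
          have : (E - x) ^ 2 = m ^ 2 := by rw [hm]; ring
          rw [this]; field_simp
        linarith

/-- truncated exponential potential -/
noncomputable def auxG (h : ℝ → ℝ) (x₀ l y : ℝ) : ℝ≥0∞ :=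
  if 0 < y then ENNReal.ofReal (Real.exp (-(l * auxH h x₀ y))) else 0

lemma auxG_meas {h : ℝ → ℝ} (hm : Monotone h) (hp : ∀ x, 0 < h x) (x₀ l : ℝ) :
    Measurable (auxG h x₀ l) := by
  unfold auxG
  refine Measurable.ite measurableSet_Ioi ?_ measurable_const
  exact (((auxH_anti hm hp x₀).measurable.const_mul l).neg.exp).ennreal_ofReal

lemma aux_step {Ω : Type*} [MeasurableSpace Ω] (P : Measure Ω) [IsProbabilityMeasure P]
    (X Y : Ω → ℝ) (hX : Measurable X) (hY : Measurable Y) (hXc : (Set.range X).Countable)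
    (hX0 : ∀ ω, 0 ≤ X ω) (hY0 : ∀ ω, 0 ≤ Y ω) (hYX : ∀ ω, Y ω ≤ X ω) {x₀ σ l : ℝ} (hl : 0 ≤ l)
    {h : ℝ → ℝ} (hm : Monotone h) (hp : ∀ x, 0 < h x)
    (hdrift : ∀ (x : ℝ), 0 < x → 0 < P {ω | X ω = x} →
      (∫ ω, Y ω ∂(ProbabilityTheory.cond P {ω | X ω = x})) ≤ x - h x)
    (hvar : ∀ (x : ℝ), 0 < x → 0 < P {ω | X ω = x} →
      (∫ ω, (Y ω -
          ∫ ω', Y ω' ∂(ProbabilityTheory.cond P {ω' | X ω' = x})) ^ 2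
        ∂(ProbabilityTheory.cond P {ω | X ω = x}))
      ≤ σ * ((∫ ω, Y ω ∂(ProbabilityTheory.cond P {ω | X ω = x})) - x) ^ 2) :
    ∫⁻ ω, auxG h x₀ l (Y ω) ∂P ≤
      ENNReal.ofReal (1 - l + l ^ 2 * (1 + σ) / 2) * ∫⁻ ω, auxG h x₀ l (X ω) ∂P := by
  have hms : ∀ x, MeasurableSet {ω | X ω = x} := fun x => hX (measurableSet_singleton x)
  have hdec : ∀ f : Ω → ℝ≥0∞, ∫⁻ ω, f ω ∂P = ∑' x : Set.range X, ∫⁻ ω in {ω | X ω = x}, f ω ∂P := by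
    intro f
    haveI := hXc.to_subtype
    rw [← lintegral_iUnion (fun x : Set.range X => hms x)]
    · have : (⋃ x : Set.range X, {ω | X ω = x}) = Set.univ := by
        ext ω; simp
      rw [this, Measure.restrict_univ]
    · intro a b hab
      rw [Function.onFun, Set.disjoint_left]
      intro ω h1 h2
      exact hab (Subtype.ext (h1.symm.trans h2))
  rw [hdec, hdec, ← ENNReal.tsum_mul_left]
  refine ENNReal.tsum_le_tsum fun ⟨x, hx⟩ => ?_
  dsimp only
  set A := {ω | X ω = x} with hA
  have hx0 : 0 ≤ x := by obtain ⟨ω, rfl⟩ := hx; exact hX0 ω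
  rcases hx0.eq_or_lt with h0 | hxp
  · rw [setLIntegral_congr_fun (hms x) (g := fun _ => 0)]
    · simp
    · intro ω hω
      have h1 : X ω = x := hω
      have : ¬ 0 < Y ω := by linarith [hYX ω]
      simp [auxG, this]
  by_cases hPA : P A = 0
  · rw [Measure.restrict_eq_zero.2 hPA]; simp
  have hPpos : 0 < P A := pos_iff_ne_zero.2 hPA
  haveI : IsProbabilityMeasure (P[|A]) := cond_isProbabilityMeasure hPA
  have hres : P.restrict A = P A • P[|A] := by
    rw [ProbabilityTheory.cond, smul_smul, ENNReal.mul_inv_cancel hPA (measure_ne_top _ _), one_smul]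
  have hae : ∀ᵐ ω ∂(P[|A]), Y ω ≤ x := by
    filter_upwards [ae_cond_mem (hms x)] with ω hω
    have h1 : X ω = x := hω
    linarith [hYX ω]
  have hc := aux_cond (P[|A]) Y hY hY0 hae (hp x) hl (hdrift x hxp hPpos) (hvar x hxp hPpos)
  have hR : ∫⁻ ω in A, auxG h x₀ l (X ω) ∂P = auxG h x₀ l x * P A := by
    rw [← setLIntegral_const]
    exact setLIntegral_congr_fun (hms x) fun ω hω => by rw [show X ω = x from hω]
  rw [hR, hres, lintegral_smul_measure, smul_eq_mul]
  have hL : ∫⁻ ω, auxG h x₀ l (Y ω) ∂(P[|A]) ≤ auxG h x₀ l x *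
      ENNReal.ofReal (1 - l + l ^ 2 * (1 + σ) / 2) := by
    refine le_trans ?_ (mul_le_mul_right hc (auxG h x₀ l x))
    rw [← lintegral_const_mul _ (by fun_prop)]
    apply lintegral_mono_ae
    filter_upwards [hae] with ω hω
    unfold auxG
    rw [if_pos hxp, ← ENNReal.ofReal_mul (Real.exp_pos _).le, ← Real.exp_add]
    split_ifs
    · apply ENNReal.ofReal_le_ofReal
      apply Real.exp_le_exp.2
      have := mul_le_mul_of_nonneg_left (auxH_diff hm hp x₀ hω) hl
      linarith
    · exact zero_le
  calc _ ≤ P A * (auxG h x₀ l x * ENNReal.ofReal (1 - l + l ^ 2 * (1 + σ) / 2)) := by gcongr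
    _ = _ := by ring

theorem stmt1
    {Ω : Type*} [MeasureSpace Ω] [IsProbabilityMeasure (ℙ : Measure Ω)]
    (X : ℕ → Ω → ℝ) (x₀ : ℝ)
    (hXmeas : ∀ t, Measurable (X t))
    (hXcount : ∀ t, (Set.range (X t)).Countable)
    (hXnonneg : ∀ t ω, 0 ≤ X t ω)
    (hXmono : ∀ t ω, X (t + 1) ω ≤ X t ω)
    (hX0 : ∀ ω, X 0 ω = x₀)
    (h : ℝ → ℝ)
    (hpos : ∀ x, 0 ≤ x → 0 < h x)
    (hmono : ∀ x y, 0 ≤ x → x ≤ y → h x ≤ h y)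
    (σ : ℝ) (hσ : 0 < σ)
    (hdrift : ∀ (t : ℕ) (x : ℝ), 0 < x → 0 < ℙ {ω | X t ω = x} →
      (∫ ω, X (t + 1) ω ∂(ProbabilityTheory.cond ℙ {ω | X t ω = x})) ≤ x - h x)
    (hvar : ∀ (t : ℕ) (x : ℝ), 0 < x → 0 < ℙ {ω | X t ω = x} →
      (∫ ω, (X (t + 1) ω -
          ∫ ω', X (t + 1) ω' ∂(ProbabilityTheory.cond ℙ {ω' | X t ω' = x})) ^ 2
        ∂(ProbabilityTheory.cond ℙ {ω | X t ω = x}))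
      ≤ σ * ((∫ ω, X (t + 1) ω ∂(ProbabilityTheory.cond ℙ {ω | X t ω = x})) - x) ^ 2)
    (δ : ℝ) (hδ0 : 0 < δ) (hδ1 : δ < 1)
    (p : ℝ) (hp0 : 0 < p) (hp1 : p < 1)
    (t₀ : ℝ)
    (ht₀ : t₀ = 2 * (σ + 1) / δ ^ 2 *
      (-Real.log p + Real.log (2 * (σ + 1) / δ ^ 2))) :
    1 - p ≤
      (ℙ {ω | (∑' s : ℕ, if t₀ < (s : ℝ) then ENNReal.ofReal (X s ω) else 0)
        ≤ ENNReal.ofReal ((1 / (1 - δ)) * ∫ φ in (0:ℝ)..x₀, φ / h φ)}).toReal := by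
  have hx0 : 0 ≤ x₀ := by
    obtain ⟨ω⟩ : Nonempty Ω := nonempty_of_isProbabilityMeasure (ℙ : Measure Ω)
    rw [← hX0 ω]; exact hXnonneg 0 ω
  -- extend `h` to a monotone positive function on the line
  set k : ℝ → ℝ := fun x => h (max x 0) with hk
  have hkm : Monotone k := fun a b hab => hmono _ _ (le_max_right _ _) (max_le_max_right 0 hab)
  have hkp : ∀ x, 0 < k x := fun x => hpos _ (le_max_right _ _)
  have hkh : ∀ x, 0 ≤ x → k x = h x := fun x hx => by simp only [hk, max_eq_left hx]
  have hint : ∫ φ in (0:ℝ)..x₀, φ / h φ = ∫ φ in (0:ℝ)..x₀, φ / k φ := by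
    apply intervalIntegral.integral_congr
    intro φ hφ
    rw [Set.uIcc_of_le hx0] at hφ
    simp only [hkh φ hφ.1]
  rw [hint]
  have hXle : ∀ t ω, X t ω ≤ x₀ := by
    intro t ω
    induction t with
    | zero => exact (hX0 ω).le
    | succ n ih => exact (hXmono n ω).trans ih
  have hσ1 : 0 < 1 + σ := by linarith
  set l := δ / (1 + σ) with hl
  have hl0 : 0 < l := by positivity
  have hld : l < δ := by rw [hl, div_lt_iff₀ hσ1]; nlinarith
  set c := l * δ / 2 with hc
  have hc0 : 0 < c := by positivity
  have hc2 : c ≤ 1 / 2 := by nlinarith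
  have hinv : 2 * (σ + 1) / δ ^ 2 = 1 / c := by rw [hc, hl]; field_simp; ring
  rw [hinv] at ht₀
  have ht0 : 0 ≤ t₀ := by
    have h1 : Real.log c ≤ 0 := Real.log_nonpos hc0.le (by linarith)
    have h2 : Real.log p < 0 := Real.log_neg hp0 hp1
    rw [ht₀, Real.log_div one_ne_zero hc0.ne', Real.log_one]
    apply mul_nonneg (by positivity); linarith
  set q := 1 - l + l ^ 2 * (1 + σ) / 2 with hq
  set u := l * (1 - δ / 2) with hu
  have hqu : q = 1 - u := by
    have : l * (1 + σ) = δ := by rw [hl]; field_simp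
    rw [hq, hu, pow_two, mul_assoc l l, this]; ring
  have hu0 : 0 ≤ u := mul_nonneg hl0.le (by linarith)
  have hu1 : u < 1 := by nlinarith
  have hq0 : 0 ≤ q := by linarith
  -- moment bound
  have hmom : ∀ t, ∫⁻ ω, auxG k x₀ l (X t ω) ≤ ENNReal.ofReal (q ^ t) := by
    intro t
    induction t with
    | zero =>
      have : ∀ ω, auxG k x₀ l (X 0 ω) ≤ 1 := by
        intro ω
        rw [hX0, auxG]
        split_ifs
        · simp [auxH]
        · simp
      refine (lintegral_mono this).trans ?_
      simp
    | succ n ih =>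
      refine (aux_step ℙ (X n) (X (n + 1)) (hXmeas n) (hXmeas _) (hXcount n) (hXnonneg n)
        (hXnonneg _) (hXmono n) hl0.le hkm hkp ?_ (hvar n)).trans ?_
      · intro x hx hP
        rw [hkh x hx.le]; exact hdrift n x hx hP
      · rw [← hq, pow_succ' q n, ENNReal.ofReal_mul hq0]
        gcongr
  -- tail bound at each time
  set B : ℕ → Set Ω := fun s => {ω | 0 < X s ω ∧ auxH k x₀ (X s ω) < (1 - δ) * s} with hB
  have htail : ∀ s, ℙ (B s) ≤ ENNReal.ofReal (Real.exp (-(c + c ^ 2 / 2)) ^ s) := by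
    intro s
    have hsub : B s ⊆ {ω | ENNReal.ofReal (Real.exp (-(l * ((1 - δ) * s)))) ≤ auxG k x₀ l (X s ω)} := by
      intro ω hω
      rw [Set.mem_setOf_eq, auxG, if_pos hω.1]
      apply ENNReal.ofReal_le_ofReal
      apply Real.exp_le_exp.2
      have := mul_le_mul_of_nonneg_left hω.2.le hl0.le
      linarith
    have h1 := mul_meas_ge_le_lintegral (μ := (ℙ : Measure Ω))
      ((auxG_meas hkm hkp x₀ l).comp (hXmeas s)) (ENNReal.ofReal (Real.exp (-(l * ((1 - δ) * s)))))
    have h2 : ENNReal.ofReal (Real.exp (-(l * ((1 - δ) * s)))) * ℙ (B s) ≤ ENNReal.ofReal (q ^ s) :=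
      (mul_le_mul_right (measure_mono hsub) _).trans (h1.trans (hmom s))
    have h3 : ℙ (B s) = ENNReal.ofReal (Real.exp (l * ((1 - δ) * s))) *
        (ENNReal.ofReal (Real.exp (-(l * ((1 - δ) * s)))) * ℙ (B s)) := by
      rw [← mul_assoc, ← ENNReal.ofReal_mul (Real.exp_pos _).le, ← Real.exp_add]
      simp
    rw [h3]
    refine (mul_le_mul_right h2 _).trans ?_
    rw [← ENNReal.ofReal_mul (Real.exp_pos _).le]
    apply ENNReal.ofReal_le_ofReal
    have h4 : Real.exp (l * ((1 - δ) * s)) = Real.exp (l * (1 - δ)) ^ s := by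
      rw [← Real.exp_nat_mul]; congr 1; ring
    rw [h4, ← mul_pow]
    apply pow_le_pow_left₀ (by positivity)
    rw [hqu]
    refine (mul_le_mul_of_nonneg_left (aux_one_sub hu0 hu1) (Real.exp_pos _).le).trans ?_
    rw [← Real.exp_add]
    apply Real.exp_le_exp.2
    have hcu : c ≤ u := by rw [hc, hu]; nlinarith
    have h5 : c ^ 2 ≤ u ^ 2 := pow_le_pow_left₀ hc0.le hcu 2
    have h6 : l * (1 - δ) - u = -c := by rw [hc, hu]; ring
    linarith
  set S := {ω | (∑' s : ℕ, if t₀ < (s : ℝ) then ENNReal.ofReal (X s ω) else 0)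
        ≤ ENNReal.ofReal ((1 / (1 - δ)) * ∫ φ in (0:ℝ)..x₀, φ / k φ)} with hS
  set B' : ℕ → Set Ω := fun s => if t₀ < (s : ℝ) then B s else ∅ with hB'
  have hBsum : ℙ (⋃ s, B' s) ≤ ENNReal.ofReal p := by
    refine (measure_iUnion_le _).trans ?_
    refine le_trans ?_ (aux_sum hc0 hc2 hp0 hp1 ht₀)
    refine ENNReal.tsum_le_tsum fun s => ?_
    simp only [hB']
    split_ifs
    · exact htail s
    · simp
  have hcover : (Set.univ : Set Ω) ⊆ S ∪ ⋃ s, B' s := by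
    intro ω _
    by_cases hb : ω ∈ ⋃ s, B' s
    · exact Or.inr hb
    · left
      refine aux_det hkm hkp hx0 (fun s => X s ω) (fun s => hXle s ω) hδ1 ht0 ?_
      intro s hs hx
      by_contra hlt
      apply hb
      rw [Set.mem_iUnion]
      refine ⟨s, ?_⟩
      simp only [hB', if_pos hs]
      exact ⟨hx, not_le.1 hlt⟩
  have hfin : (1 : ℝ≥0∞) ≤ ℙ S + ENNReal.ofReal p := by
    calc (1 : ℝ≥0∞) = ℙ (Set.univ : Set Ω) := measure_univ.symm
      _ ≤ ℙ (S ∪ ⋃ s, B' s) := measure_mono hcover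
      _ ≤ ℙ S + ℙ (⋃ s, B' s) := measure_union_le _ _
      _ ≤ _ := by gcongr
  have h7 := ENNReal.toReal_mono (by simp) hfin
  rw [ENNReal.toReal_add (measure_ne_top _ _) ENNReal.ofReal_ne_top, ENNReal.toReal_ofReal hp0.le,
    ENNReal.toReal_one] at h7
  linarith
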